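/- Given one-dimensional Gaussian measures N(μ_n, σ_n²) for n = 1, …, N with σ_n > 0, the unique minimizer over all probability measures ν of Σ_{n=1}^N W₂²(ν, N(μ_n, σ_n²)) is the Gaussian N(μ̄, σ̄²) with μ̄ = (1/N)Σ μ_n and σ̄ = (1/N)Σ σ_n. -/

import Mathlib

open MeasureTheory ProbabilityTheory ENNReal

/-- The set of couplings of two measures on ℝ. -/
def couplings (μ ν : Measure ℝ) : Set (Measure (ℝ × ℝ)) :=
  {γ | γ.map Prod.fst = μ ∧ γ.map Prod.snd = ν}

/-- The squared 2-Wasserstein distance between measures on ℝ. -/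
noncomputable def W2sq (μ ν : Measure ℝ) : ℝ≥0∞ :=
  ⨅ γ ∈ couplings μ ν, ∫⁻ p, ENNReal.ofReal ((p.1 - p.2) ^ 2) ∂γ


lemma cpl_prob {ν P : Measure ℝ} [IsProbabilityMeasure ν] {γ : Measure (ℝ × ℝ)}
    (h : γ ∈ couplings ν P) : IsProbabilityMeasure γ := by
  have h1 := h.1
  have : IsProbabilityMeasure (γ.map Prod.fst) := by rw [h1]; infer_instance
  exact Measure.isProbabilityMeasure_of_map Prod.fst

lemma cpl_fst {ν P : Measure ℝ} {γ : Measure (ℝ × ℝ)}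
    (h : γ ∈ couplings ν P) (hν : MemLp id 2 ν) : MemLp (fun p : ℝ × ℝ => p.1) 2 γ := by
  rw [← h.1] at hν
  exact (memLp_map_measure_iff (g := id) (f := Prod.fst) (by fun_prop) (by fun_prop)).1 hν

lemma cpl_snd {ν P : Measure ℝ} {γ : Measure (ℝ × ℝ)}
    (h : γ ∈ couplings ν P) (hP : MemLp id 2 P) : MemLp (fun p : ℝ × ℝ => p.2) 2 γ := by
  rw [← h.2] at hP
  exact (memLp_map_measure_iff (g := id) (f := Prod.snd) (by fun_prop) (by fun_prop)).1 hP

lemma cost_eq {γ : Measure (ℝ × ℝ)} (h1 : MemLp (fun p : ℝ × ℝ => p.1) 2 γ)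
    (h2 : MemLp (fun p : ℝ × ℝ => p.2) 2 γ) :
    ∫⁻ p, ENNReal.ofReal ((p.1 - p.2) ^ 2) ∂γ = ENNReal.ofReal (∫ p, (p.1 - p.2) ^ 2 ∂γ) := by
  rw [ofReal_integral_eq_lintegral_ofReal]
  · exact (h1.sub h2).integrable_sq
  · exact Filter.Eventually.of_forall fun p => sq_nonneg _

/-- finite cost to a measure with second moment gives second moment -/
lemma memLp_of_W2sq {ν P : Measure ℝ} (hP : MemLp id 2 P) (h : W2sq ν P ≠ ⊤) :
    MemLp id 2 ν := by
  have h' : W2sq ν P < ⊤ := lt_top_iff_ne_top.2 h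
  unfold W2sq at h'
  simp only [iInf_lt_iff] at h'
  obtain ⟨γ, hγ, hc⟩ := h'
  have h2 := cpl_snd hγ hP
  have hd : MemLp (fun p : ℝ × ℝ => p.1 - p.2) 2 γ := by
    rw [memLp_two_iff_integrable_sq (by fun_prop)]
    refine ⟨by fun_prop, ?_⟩
    rw [hasFiniteIntegral_iff_ofReal (Filter.Eventually.of_forall fun p => sq_nonneg _)]
    exact hc
  have h1 : MemLp (fun p : ℝ × ℝ => p.1) 2 γ := by
    have := hd.add h2
    refine this.congr_norm (by fun_prop) (Filter.Eventually.of_forall fun p => ?_)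
    simp
  rw [← hγ.1]
  exact (memLp_map_measure_iff (by fun_prop) (by fun_prop)).2 h1

lemma cost_identity {ν P : Measure ℝ} [IsProbabilityMeasure ν] {γ : Measure (ℝ × ℝ)}
    (h : γ ∈ couplings ν P) (hν : MemLp id 2 ν) (hP : MemLp id 2 P) (u r : ℝ) (hr : 0 < r) :
    ∫ p, (p.1 - p.2) ^ 2 ∂γ = r * ∫ p, (p.1 - (p.2 - u) / r) ^ 2 ∂γ
      + ((1 - r) * ∫ x, x ^ 2 ∂ν - 2 * u * ∫ x, x ∂ν)
      + ∫ y, (y ^ 2 - r * ((y - u) / r) ^ 2) ∂P := by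
  have hγp := cpl_prob h
  have h1 := cpl_fst h hν
  have h2 := cpl_snd h hP
  have h3 : MemLp (fun p : ℝ × ℝ => (p.2 - u) / r) 2 γ := by
    have := (h2.sub (memLp_const u)).const_mul r⁻¹
    refine this.congr_norm (by fun_prop) (Filter.Eventually.of_forall fun p => ?_)
    simp [div_eq_inv_mul]
  have e1 : ∫ x, x ^ 2 ∂ν = ∫ p, p.1 ^ 2 ∂γ := by
    rw [← h.1, integral_map (by fun_prop) (by fun_prop)]
  have e2 : ∫ x, x ∂ν = ∫ p, p.1 ∂γ := by
    rw [← h.1, integral_map (by fun_prop) (by fun_prop)]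
  have e3 : ∫ y, (y ^ 2 - r * ((y - u) / r) ^ 2) ∂P
      = ∫ p, (p.2 ^ 2 - r * ((p.2 - u) / r) ^ 2) ∂γ := by
    rw [← h.2, integral_map (by fun_prop) (by fun_prop)]
  have i1 : Integrable (fun p : ℝ × ℝ => (p.1 - (p.2 - u) / r) ^ 2) γ := (h1.sub h3).integrable_sq
  have i2 := h1.integrable_sq
  have i3 : Integrable (fun p : ℝ × ℝ => p.1) γ := h1.integrable (by norm_num)
  have i4 : Integrable (fun p : ℝ × ℝ => p.2 ^ 2 - r * ((p.2 - u) / r) ^ 2) γ :=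
    h2.integrable_sq.sub (h3.integrable_sq.const_mul r)
  have i5 : Integrable (fun p : ℝ × ℝ => (1 - r) * p.1 ^ 2 - 2 * u * p.1) γ :=
    (i2.const_mul _).sub (i3.const_mul _)
  have i6 : Integrable (fun p : ℝ × ℝ => r * (p.1 - (p.2 - u) / r) ^ 2
      + ((1 - r) * p.1 ^ 2 - 2 * u * p.1)) γ := (i1.const_mul _).add i5
  rw [e1, e2, e3, ← integral_const_mul, ← integral_const_mul, ← integral_const_mul,
    ← integral_sub (i2.const_mul _) (i3.const_mul _),
    ← integral_add (i1.const_mul _) i5,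
    ← integral_add i6 i4]
  refine integral_congr_ae (Filter.Eventually.of_forall fun p => ?_)
  simp only
  field_simp
  ring

/-- key lower bound -/
lemma W2sq_lower {ν P G : Measure ℝ} [IsProbabilityMeasure ν]
    (hν : MemLp id 2 ν) (hP : MemLp id 2 P) (u r : ℝ) (hr : 0 < r)
    (hG : P.map (fun y => (y - u) / r) = G) (hfin : W2sq ν P ≠ ⊤) :
    r * (W2sq ν G).toReal
      + ((1 - r) * ∫ x, x ^ 2 ∂ν - 2 * u * ∫ x, x ∂ν)
      + ∫ y, (y ^ 2 - r * ((y - u) / r) ^ 2) ∂P ≤ (W2sq ν P).toReal := by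
  rw [← ENNReal.ofReal_le_iff_le_toReal hfin]
  rw [show W2sq ν P = ⨅ γ ∈ couplings ν P, ∫⁻ p, ENNReal.ofReal ((p.1 - p.2) ^ 2) ∂γ from rfl]
  refine le_iInf₂ fun γ h => ?_
  have hγp := cpl_prob h
  have h1 := cpl_fst h hν
  have h2 := cpl_snd h hP
  have h3 : MemLp (fun p : ℝ × ℝ => (p.2 - u) / r) 2 γ := by
    have := (h2.sub (memLp_const u)).const_mul r⁻¹
    refine this.congr_norm (by fun_prop) (Filter.Eventually.of_forall fun p => ?_)
    simp [div_eq_inv_mul]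
  rw [cost_eq h1 h2, cost_identity h hν hP u r hr]
  refine ENNReal.ofReal_le_ofReal ?_
  have key : (W2sq ν G).toReal ≤ ∫ p, (p.1 - (p.2 - u) / r) ^ 2 ∂γ := by
    refine ENNReal.toReal_le_of_le_ofReal (integral_nonneg fun p => sq_nonneg _) ?_
    have i1 : Integrable (fun p : ℝ × ℝ => (p.1 - (p.2 - u) / r) ^ 2) γ :=
      (h1.sub h3).integrable_sq
    rw [ofReal_integral_eq_lintegral_ofReal i1
      (Filter.Eventually.of_forall fun p => sq_nonneg _)]
    have hm : γ.map (fun p : ℝ × ℝ => (p.1, (p.2 - u) / r)) ∈ couplings ν G := by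
      constructor
      · rw [Measure.map_map (by fun_prop) (by fun_prop)]
        exact h.1
      · rw [Measure.map_map (by fun_prop) (by fun_prop), ← hG, ← h.2,
          Measure.map_map (by fun_prop) (by fun_prop)]
        rfl
    refine (iInf₂_le _ hm).trans (le_of_eq ?_)
    rw [lintegral_map (by fun_prop) (by fun_prop)]
  gcongr

lemma W2sq_upper {P G : Measure ℝ} [IsProbabilityMeasure G]
    (hG2 : MemLp id 2 G) (hP : MemLp id 2 P) (u r : ℝ) (hr : 0 < r)
    (hG : G.map (fun z => u + r * z) = P) :
    W2sq G P ≤ ENNReal.ofReal (((1 - r) * ∫ x, x ^ 2 ∂G - 2 * u * ∫ x, x ∂G)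
      + ∫ y, (y ^ 2 - r * ((y - u) / r) ^ 2) ∂P) ∧
    0 ≤ (((1 - r) * ∫ x, x ^ 2 ∂G - 2 * u * ∫ x, x ∂G)
      + ∫ y, (y ^ 2 - r * ((y - u) / r) ^ 2) ∂P) := by
  have hm : G.map (fun z : ℝ => (z, u + r * z)) ∈ couplings G P := by
    constructor
    · rw [Measure.map_map (by fun_prop) (by fun_prop)]
      exact Measure.map_id
    · rw [Measure.map_map (by fun_prop) (by fun_prop)]
      exact hG
  have hid := cost_identity hm hG2 hP u r hr
  have hz : ∫ p, (p.1 - (p.2 - u) / r) ^ 2 ∂(G.map (fun z : ℝ => (z, u + r * z))) = 0 := by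
    rw [integral_map (by fun_prop) (by fun_prop)]
    have : ∀ z : ℝ, (z - (u + r * z - u) / r) ^ 2 = 0 := fun z => by
      field_simp
      ring
    simp only [this, integral_zero]
  rw [hz, mul_zero, zero_add] at hid
  rw [← hid]
  refine ⟨?_, integral_nonneg fun p => sq_nonneg _⟩
  rw [← cost_eq (cpl_fst hm hG2) (cpl_snd hm hP)]
  exact iInf₂_le _ hm

lemma charFun_diff_le {ν G : Measure ℝ} [IsProbabilityMeasure ν] [IsProbabilityMeasure G]
    {γ : Measure (ℝ × ℝ)} (h : γ ∈ couplings ν G) (t δ : ℝ) (hδ : 0 < δ)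
    (hc : ∫⁻ p, ENNReal.ofReal ((p.1 - p.2) ^ 2) ∂γ < ENNReal.ofReal (δ ^ 2)) :
    ‖charFun ν t - charFun G t‖ ≤ |t| * δ := by
  have hγp := cpl_prob h
  have hint : Integrable (fun p : ℝ × ℝ => (p.1 - p.2) ^ 2) γ := by
    refine ⟨by fun_prop, ?_⟩
    rw [hasFiniteIntegral_iff_ofReal (Filter.Eventually.of_forall fun p => sq_nonneg _)]
    exact hc.trans ENNReal.ofReal_lt_top
  have hc' : ∫ p, (p.1 - p.2) ^ 2 ∂γ ≤ δ ^ 2 := by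
    rw [← ofReal_integral_eq_lintegral_ofReal hint
      (Filter.Eventually.of_forall fun p => sq_nonneg _)] at hc
    exact ((ENNReal.ofReal_lt_ofReal_iff (by positivity)).1 hc).le
  have b1 : Integrable (fun p : ℝ × ℝ => Complex.exp (t * p.1 * Complex.I)) γ := by
    refine Integrable.of_bound (by fun_prop) 1 (Filter.Eventually.of_forall fun p => ?_)
    rw [← Complex.ofReal_mul, Complex.norm_exp_ofReal_mul_I]
  have b2 : Integrable (fun p : ℝ × ℝ => Complex.exp (t * p.2 * Complex.I)) γ := by
    refine Integrable.of_bound (by fun_prop) 1 (Filter.Eventually.of_forall fun p => ?_)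
    rw [← Complex.ofReal_mul, Complex.norm_exp_ofReal_mul_I]
  have e1 : charFun ν t = ∫ p, Complex.exp (t * p.1 * Complex.I) ∂γ := by
    rw [charFun_apply_real, ← h.1, integral_map (by fun_prop) (by fun_prop)]
  have e2 : charFun G t = ∫ p, Complex.exp (t * p.2 * Complex.I) ∂γ := by
    rw [charFun_apply_real, ← h.2, integral_map (by fun_prop) (by fun_prop)]
  rw [e1, e2, ← integral_sub b1 b2]
  have hb : ∀ p : ℝ × ℝ, ‖Complex.exp (t * p.1 * Complex.I) - Complex.exp (t * p.2 * Complex.I)‖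
      ≤ |t| * (δ / 2 + (2 * δ)⁻¹ * (p.1 - p.2) ^ 2) := by
    intro p
    have : Complex.exp (t * p.1 * Complex.I) - Complex.exp (t * p.2 * Complex.I)
        = Complex.exp ((t * p.2 : ℝ) * Complex.I) *
          (Complex.exp (Complex.I * (t * (p.1 - p.2) : ℝ)) - 1) := by
      rw [mul_sub, ← Complex.exp_add]
      push_cast
      ring_nf
    rw [this, norm_mul, Complex.norm_exp_ofReal_mul_I, one_mul]
    refine Real.norm_exp_I_mul_ofReal_sub_one_le.trans ?_
    rw [Real.norm_eq_abs, abs_mul]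
    gcongr
    have : δ / 2 + (2 * δ)⁻¹ * (p.1 - p.2) ^ 2 - |p.1 - p.2|
        = (2 * δ)⁻¹ * (|p.1 - p.2| - δ) ^ 2 := by
      rw [← sq_abs (p.1 - p.2)]
      field_simp
      ring
    have h0 : 0 ≤ (2 * δ)⁻¹ * (|p.1 - p.2| - δ) ^ 2 := by positivity
    linarith
  have hi : Integrable (fun p : ℝ × ℝ => |t| * (δ / 2 + (2 * δ)⁻¹ * (p.1 - p.2) ^ 2)) γ :=
    ((integrable_const _).add (hint.const_mul _)).const_mul _
  refine (norm_integral_le_of_norm_le hi (Filter.Eventually.of_forall hb)).trans ?_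
  rw [integral_const_mul, integral_add (integrable_const _) (hint.const_mul _),
    integral_const_mul]
  gcongr
  simp only [integral_const, probReal_univ, one_smul]
  have : (2 * δ)⁻¹ * ∫ p, (p.1 - p.2) ^ 2 ∂γ ≤ (2 * δ)⁻¹ * δ ^ 2 := by gcongr
  have e : (2 * δ)⁻¹ * δ ^ 2 = δ / 2 := by field_simp
  linarith

lemma eq_of_W2sq_zero {ν G : Measure ℝ} [IsProbabilityMeasure ν] [IsProbabilityMeasure G]
    (h : W2sq ν G = 0) : ν = G := by
  refine Measure.ext_of_charFun (funext fun t => ?_)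
  rw [← sub_eq_zero, ← norm_le_zero_iff]
  refine le_of_forall_pos_le_add fun ε hε => ?_
  rw [zero_add]
  have hδ : 0 < ε / (|t| + 1) := by positivity
  have hlt : W2sq ν G < ENNReal.ofReal ((ε / (|t| + 1)) ^ 2) := by
    rw [h]
    exact ENNReal.ofReal_pos.2 (by positivity)
  unfold W2sq at hlt
  simp only [iInf_lt_iff] at hlt
  obtain ⟨γ, hγ, hc⟩ := hlt
  refine (charFun_diff_le hγ t _ hδ hc).trans ?_
  rw [← mul_div_assoc, div_le_iff₀ (by positivity)]
  nlinarith

lemma gauss_affine (m u r : ℝ) (v w : NNReal) (hw : (w : ℝ) = r ^ 2 * v) :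
    (gaussianReal m v).map (fun z => u + r * z) = gaussianReal (u + r * m) w := by
  have : (fun z : ℝ => u + r * z) = (fun z => u + z) ∘ (fun z => r * z) := rfl
  rw [this, ← Measure.map_map (by fun_prop) (by fun_prop), gaussianReal_map_const_mul,
    gaussianReal_map_const_add, add_comm]
  congr 1
  ext
  rw [hw]
  rfl

lemma W2sq_fin {ν P : Measure ℝ} [IsProbabilityMeasure ν] [IsProbabilityMeasure P]
    (hν : MemLp id 2 ν) (hP : MemLp id 2 P) : W2sq ν P ≠ ⊤ := by
  have hm : ν.prod P ∈ couplings ν P := by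
    constructor <;> simp
  refine ne_top_of_le_ne_top ?_ (iInf₂_le _ hm)
  rw [cost_eq (cpl_fst hm hν) (cpl_snd hm hP)]
  exact ENNReal.ofReal_ne_top

/-- The unique minimizer of ν ↦ Σₙ W₂²(ν, N(μₙ, σₙ²)) over probability measures is
the Gaussian with mean (1/N)Σ μₙ and standard deviation (1/N)Σ σₙ. -/
theorem stmt_14 {N : ℕ} (hN : 0 < N) (μ : Fin N → ℝ) (σ : Fin N → NNReal)
    (hσ : ∀ n, 0 < σ n) :
    ∀ ν : Measure ℝ, IsProbabilityMeasure ν →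
      (∑ n, W2sq (gaussianReal ((1 / (N : ℝ)) * ∑ n', μ n') ((((N : NNReal))⁻¹ * ∑ n', σ n') ^ 2))
          (gaussianReal (μ n) (σ n ^ 2)))
        ≤ ∑ n, W2sq ν (gaussianReal (μ n) (σ n ^ 2)) ∧
      ((∑ n, W2sq ν (gaussianReal (μ n) (σ n ^ 2))) =
          ∑ n, W2sq (gaussianReal ((1 / (N : ℝ)) * ∑ n', μ n')
            ((((N : NNReal))⁻¹ * ∑ n', σ n') ^ 2)) (gaussianReal (μ n) (σ n ^ 2)) →
        ν = gaussianReal ((1 / (N : ℝ)) * ∑ n', μ n') ((((N : NNReal))⁻¹ * ∑ n', σ n') ^ 2)) := by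
  intro ν hν
  have hN' : (0 : ℝ) < N := by exact_mod_cast hN
  have : Nonempty (Fin N) := ⟨⟨0, hN⟩⟩
  set m : ℝ := (1 / (N : ℝ)) * ∑ n', μ n' with hm
  set s : NNReal := ((N : NNReal))⁻¹ * ∑ n', σ n' with hs
  have hsum : 0 < ∑ n', σ n' := Finset.sum_pos (fun n _ => hσ n) Finset.univ_nonempty
  have hspos : 0 < s := mul_pos (inv_pos.2 (by exact_mod_cast hN)) hsum
  have hsR : (0 : ℝ) < s := hspos
  have hs' : (s : ℝ) = (N : ℝ)⁻¹ * ∑ n', (σ n' : ℝ) := by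
    rw [hs]; push_cast; rfl
  set G := gaussianReal m (s ^ 2) with hG
  have hg : ∀ a v, MemLp id 2 (gaussianReal a v) := fun a v =>
    memLp_id_gaussianReal' 2 (by norm_num)
  have hG2 : MemLp id 2 G := hg _ _
  obtain ⟨r, hr⟩ : ∃ r : Fin N → ℝ, ∀ n, r n = σ n / s := ⟨_, fun n => rfl⟩
  obtain ⟨u, hu⟩ : ∃ u : Fin N → ℝ, ∀ n, u n = μ n - r n * m := ⟨_, fun n => rfl⟩
  have hrpos : ∀ n, 0 < r n := fun n => by
    rw [hr]; exact div_pos (hσ n) hsR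
  have hrs : ∑ n, r n = N := by
    simp only [hr]
    rw [← Finset.sum_div, div_eq_iff hsR.ne', hs']
    field_simp
  have hus : ∑ n, u n = 0 := by
    simp only [hu]
    rw [Finset.sum_sub_distrib, ← Finset.sum_mul, hrs, hm]
    field_simp
    ring
  set D : Fin N → ℝ := fun n =>
    ∫ y, (y ^ 2 - r n * ((y - u n) / r n) ^ 2) ∂(gaussianReal (μ n) (σ n ^ 2)) with hD
  have hA : ∀ a b : ℝ, ∑ n, ((1 - r n) * a - 2 * u n * b) = 0 := by
    intro a b
    rw [Finset.sum_sub_distrib, ← Finset.sum_mul, ← Finset.sum_mul, Finset.sum_sub_distrib,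
      ← Finset.mul_sum, hrs, hus]
    simp
  have hmapG : ∀ n, G.map (fun z => u n + r n * z) = gaussianReal (μ n) (σ n ^ 2) := by
    intro n
    rw [hG, gauss_affine m (u n) (r n) (s ^ 2) (σ n ^ 2)]
    · congr 1
      rw [hu]; ring
    · rw [hr]; push_cast; field_simp
  have hmapP : ∀ n, (gaussianReal (μ n) (σ n ^ 2)).map (fun y => (y - u n) / r n) = G := by
    intro n
    rw [← hmapG n, Measure.map_map (by fun_prop) (by fun_prop)]
    have : (fun y => (y - u n) / r n) ∘ (fun z => u n + r n * z) = id := by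
      funext z
      have := (hrpos n).ne'
      simp only [Function.comp, id]
      field_simp
      ring
    rw [this, Measure.map_id]
  have hup := fun n => W2sq_upper hG2 (hg (μ n) (σ n ^ 2)) (u n) (r n) (hrpos n) (hmapG n)
  have hGle : ∑ n, W2sq G (gaussianReal (μ n) (σ n ^ 2)) ≤ ENNReal.ofReal (∑ n, D n) := by
    have e : ∑ n, D n = ∑ n, (((1 - r n) * ∫ x, x ^ 2 ∂G - 2 * u n * ∫ x, x ∂G) + D n) := by
      rw [Finset.sum_add_distrib, hA, zero_add]
    rw [e, ENNReal.ofReal_sum_of_nonneg fun n _ => (hup n).2]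
    exact Finset.sum_le_sum fun n _ => (hup n).1
  have main : ∑ n, W2sq ν (gaussianReal (μ n) (σ n ^ 2)) ≠ ⊤ →
      MemLp id 2 ν ∧ N * (W2sq ν G).toReal + ∑ n, D n
        ≤ (∑ n, W2sq ν (gaussianReal (μ n) (σ n ^ 2))).toReal := by
    intro hfin
    have hfin' : ∀ n, W2sq ν (gaussianReal (μ n) (σ n ^ 2)) ≠ ⊤ := fun n =>
      ENNReal.sum_ne_top.1 hfin n (Finset.mem_univ n)
    have hν2 : MemLp id 2 ν := memLp_of_W2sq (hg _ _) (hfin' ⟨0, hN⟩)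
    refine ⟨hν2, ?_⟩
    rw [ENNReal.toReal_sum fun n _ => hfin' n]
    have e : N * (W2sq ν G).toReal + ∑ n, D n = ∑ n, (r n * (W2sq ν G).toReal
        + ((1 - r n) * ∫ x, x ^ 2 ∂ν - 2 * u n * ∫ x, x ∂ν) + D n) := by
      rw [Finset.sum_add_distrib, Finset.sum_add_distrib, hA, add_zero, ← Finset.sum_mul, hrs]
    rw [e]
    exact Finset.sum_le_sum fun n _ =>
      W2sq_lower hν2 (hg _ _) (u n) (r n) (hrpos n) (hmapP n) (hfin' n)
  have hD0 : 0 ≤ ∑ n, D n := by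
    have e : ∑ n, D n = ∑ n, (((1 - r n) * ∫ x, x ^ 2 ∂G - 2 * u n * ∫ x, x ∂G) + D n) := by
      rw [Finset.sum_add_distrib, hA, zero_add]
    rw [e]
    exact Finset.sum_nonneg fun n _ => (hup n).2
  constructor
  · by_cases hfin : ∑ n, W2sq ν (gaussianReal (μ n) (σ n ^ 2)) = ⊤
    · rw [hfin]; exact le_top
    · refine hGle.trans (ENNReal.ofReal_le_of_le_toReal ?_)
      have h1 := (main hfin).2
      have h2 : 0 ≤ N * (W2sq ν G).toReal := by positivity
      linarith
  · intro heq
    have hle : ∑ n, W2sq ν (gaussianReal (μ n) (σ n ^ 2)) ≤ ENNReal.ofReal (∑ n, D n) :=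
      heq.le.trans hGle
    obtain ⟨hν2, hlow⟩ := main (ne_top_of_le_ne_top ENNReal.ofReal_ne_top hle)
    have h3 := ENNReal.toReal_le_of_le_ofReal hD0 hle
    have h4 : (W2sq ν G).toReal = 0 := by
      have h5 : (N : ℝ) * (W2sq ν G).toReal ≤ 0 := by linarith
      have h6 : 0 ≤ (W2sq ν G).toReal := ENNReal.toReal_nonneg
      nlinarith
    refine eq_of_W2sq_zero ?_
    rcases (ENNReal.toReal_eq_zero_iff _).1 h4 with h | h
    · exact h
    · exact absurd h (W2sq_fin hν2 hG2)
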